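/- For every n the limiting ratio μ_n(S_n) of the set of simple tautologies exists, and liminf_{n→∞} μ_n(S_n) ≥ 0.12161. -/

import Mathlib

/-- An and/or tree skeleton: leaves carry a variable index and a polarity
(`true` = positive literal, `false` = negated literal); internal nodes carry
a connective (`true` = AND, `false` = OR) and a list of children. -/
inductive AT (n : ℕ) : Type
  | leaf : Fin n → Bool → AT n
  | node : Bool → List (AT n) → AT n

namespace AT

/-- The connective at the root, if the root is an internal node. -/
def rootConn {n : ℕ} : AT n → Option Bool
  | .leaf _ _ => none
  | .node c _ => some c

/-- Whether a tree is a single leaf. -/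
def isLeafB {n : ℕ} : AT n → Bool
  | .leaf _ _ => true
  | .node _ _ => false

/-- The children of the root. -/
def rootChildren {n : ℕ} : AT n → List (AT n)
  | .leaf _ _ => []
  | .node _ ts => ts

/-- Well-formedness: an associative tree is a plane tree in which each internal
node has at least two children, no internal node has the same connective as its
parent (stratification), and leaves carry literals. -/
inductive WF {n : ℕ} : AT n → Prop
  | leaf (i : Fin n) (b : Bool) : WF (.leaf i b)
  | node (c : Bool) (ts : List (AT n)) :
      2 ≤ ts.length → (∀ t ∈ ts, WF t) → (∀ t ∈ ts, rootConn t ≠ some c) →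
      WF (.node c ts)

mutual
/-- The size of a tree: its total number of nodes. -/
def size {n : ℕ} : AT n → ℕ
  | .leaf _ _ => 1
  | .node _ ts => 1 + sizeList ts
def sizeList {n : ℕ} : List (AT n) → ℕ
  | [] => 0
  | t :: ts => size t + sizeList ts
end

mutual
/-- The Boolean function computed by a tree. -/
def eval {n : ℕ} : AT n → (Fin n → Bool) → Bool
  | .leaf i b, x => if b then x i else ! x i
  | .node c ts, x => evalList c ts x
def evalList {n : ℕ} : Bool → List (AT n) → (Fin n → Bool) → Bool
  | c, [], _ => c
  | c, t :: ts, x => if c then eval t x && evalList c ts x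
                     else eval t x || evalList c ts x
end

end AT

open AT

/-- Number of associative trees of size `m` in a family `𝒯`. -/
noncomputable def countIn (n : ℕ) (𝒯 : Set (AT n)) (m : ℕ) : ℕ :=
  Nat.card {t : AT n // t ∈ 𝒯 ∧ WF t ∧ size t = m}

/-- `A n m` is the number of associative trees of size `m` on `n` variables. -/
noncomputable def A (n m : ℕ) : ℕ := countIn n Set.univ m

/-- `Pmn n m f` is the proportion, among associative trees of size `m` on `n`
variables, of those computing the Boolean function `f`. -/
noncomputable def Pmn (n m : ℕ) (f : (Fin n → Bool) → Bool) : ℝ :=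
  (countIn n {t | eval t = f} m : ℝ) / (A n m : ℝ)

/-- Ratio of trees of size `m` in the family `𝒯` among all trees of size `m`. -/
noncomputable def ratio (n : ℕ) (𝒯 : Set (AT n)) (m : ℕ) : ℝ :=
  (countIn n 𝒯 m : ℝ) / (A n m : ℝ)

/-- `HasLimRatio n 𝒯 μ` : the limiting ratio of the family `𝒯` exists and is `μ`. -/
def HasLimRatio (n : ℕ) (𝒯 : Set (AT n)) (μ : ℝ) : Prop :=
  Filter.Tendsto (ratio n 𝒯) Filter.atTop (nhds μ)

/-- Extension of a Boolean function of `n₀` variables to `n ≥ n₀` variables. -/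
def extend {n₀ n : ℕ} (h : n₀ ≤ n) (f : (Fin n₀ → Bool) → Bool) :
    (Fin n → Bool) → Bool :=
  fun x => f (fun j => x (Fin.castLE h j))

open Classical in
/-- The tree size complexity of a Boolean function. -/
noncomputable def Lcomp (n : ℕ) (f : (Fin n → Bool) → Bool) : ℕ :=
  if f = (fun _ => true) ∨ f = (fun _ => false) then 0
  else if ∃ i : Fin n, f = (fun x => x i) ∨ f = (fun x => ! x i) then 2
  else sInf {m | ∃ t : AT n, WF t ∧ size t = m ∧ eval t = f}

/-- The set `S_n` of simple tautologies: `∨`-rooted associative trees with, for some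
variable `x`, both a leaf labelled `x` and a leaf labelled `x̄` among the children
of the root. -/
def SimpleTauto (n : ℕ) : Set (AT n) :=
  {t | rootConn t = some false ∧
    ∃ i : Fin n, AT.leaf i true ∈ rootChildren t ∧ AT.leaf i false ∈ rootChildren t}

section Analytic
open Filter Topology PowerSeries

/-- Coefficient ratio of `f` with respect to the reference sequence `e` tends to `L`. -/
def HasL (e : ℕ → ℝ) (f : PowerSeries ℝ) (L : ℝ) : Prop :=
  Tendsto (fun m => coeff m f / e m) atTop (𝓝 L)

/-- `r` converges absolutely at radius `R`. -/
def Good (R : ℝ) (r : PowerSeries ℝ) : Prop :=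
  Summable fun k => |coeff k r| * R ^ k

/-- Value of the series at `ρ`. -/
noncomputable def ev (ρ : ℝ) (r : PowerSeries ℝ) : ℝ := ∑' k, coeff k r * ρ ^ k

/-- Admissible reference sequence. -/
structure RefSeq (e : ℕ → ℝ) (ρ R : ℝ) : Prop where
  pos : ∀ m, 0 < e m
  rho : 0 < ρ
  lt : ρ < R
  lim : Tendsto (fun m => e m / e (m + 1)) atTop (𝓝 ρ)

variable {e : ℕ → ℝ} {ρ R : ℝ}

lemma eventually_mono_bound (h : ℕ → ℝ) (hp : ∀ m, 0 < h m) (J : ℕ)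
    (hm : ∀ i, J ≤ i → h i ≤ h (i + 1)) : ∃ K, 0 ≤ K ∧ ∀ j m, j ≤ m → h j ≤ K * h m := by
  induction J with
  | zero =>
    refine ⟨1, zero_le_one, fun j m hjm => ?_⟩
    rw [one_mul]
    exact monotone_nat_of_le_succ (fun i => hm i (Nat.zero_le _)) hjm
  | succ J ih =>
    obtain ⟨K, hK0, hK⟩ : ∃ K, 0 ≤ K ∧ ∀ j m, J + 1 ≤ j → j ≤ m → h j ≤ K * h m := by
      refine ⟨1, zero_le_one, fun j m hj hjm => ?_⟩
      rw [one_mul]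
      induction m, hjm using Nat.le_induction with
      | base => exact le_rfl
      | succ k hk ih2 => exact ih2.trans (hm k (by omega))
    have hfin : ∃ M, ∀ i ≤ J + 1, h i ≤ M := by
      obtain ⟨M, hM⟩ := ((Set.finite_Iic (J+1)).image h).bddAbove
      exact ⟨M, fun i hi => hM ⟨i, hi, rfl⟩⟩
    have hfin2 : ∃ δ, 0 < δ ∧ ∀ i ≤ J + 1, δ ≤ h i := by
      obtain ⟨M, hM⟩ := ((Set.finite_Iic (J+1)).image (fun i => (h i)⁻¹)).bddAbove
      have hM0 : 0 < M := lt_of_lt_of_le (inv_pos.2 (hp 0)) (hM ⟨0, by simp, rfl⟩)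
      exact ⟨M⁻¹, inv_pos.2 hM0, fun i hi => by
        rw [inv_le_comm₀ hM0 (hp i)]; exact hM ⟨i, hi, rfl⟩⟩
    obtain ⟨M, hM⟩ := hfin
    obtain ⟨δ, hδ, hδ2⟩ := hfin2
    have hM0 : 0 < M := (hp 0).trans_le (hM 0 (by omega))
    have hlow : ∀ m, δ ≤ h m ∨ h (J+1) ≤ K * h m := by
      intro m
      rcases le_total m (J+1) with h1 | h1
      · exact Or.inl (hδ2 m h1)
      · exact Or.inr (hK _ _ le_rfl h1)
    refine ⟨K + M / δ + M / δ * K, by positivity, fun j m hjm => ?_⟩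
    have hmp := hp m
    have hMd : 0 < M / δ := by positivity
    rcases le_total (J+1) j with h1 | h1
    · have := hK j m h1 hjm
      nlinarith [mul_pos hMd hmp, mul_nonneg (mul_nonneg hMd.le hK0) hmp.le]
    · have hj := hM j h1
      have hMeq : M = M / δ * δ := by field_simp
      rcases hlow m with h2 | h2
      · have : M / δ * δ ≤ M / δ * h m := by gcongr
        nlinarith [mul_nonneg hK0 hmp.le, mul_nonneg (mul_nonneg hMd.le hK0) hmp.le]
      · have h3 := hδ2 (J+1) le_rfl
        have : M / δ * δ ≤ M / δ * (K * h m) := by gcongr; linarith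
        nlinarith [mul_nonneg hK0 hmp.le, mul_pos hMd hmp]

lemma RefSeq.bound (he : RefSeq e ρ R) :
    ∃ K, 0 ≤ K ∧ ∀ m k, k ≤ m → e (m - k) / e m ≤ K * R ^ k := by
  have hR : 0 < R := he.rho.trans he.lt
  obtain ⟨J, hJ⟩ := eventually_atTop.1 (he.lim.eventually (gt_mem_nhds he.lt))
  obtain ⟨K, hK0, hK⟩ := eventually_mono_bound (fun m => e m * R ^ m)
    (fun m => mul_pos (he.pos m) (pow_pos hR m)) J (fun i hi => by
      have h1 := hJ i hi
      rw [div_lt_iff₀ (he.pos _)] at h1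
      have : e i * R ^ i ≤ (R * e (i+1)) * R ^ i := by gcongr
      simpa [pow_succ, mul_comm, mul_left_comm, mul_assoc] using this)
  refine ⟨K, hK0, fun m k hk => ?_⟩
  rw [div_le_iff₀ (he.pos m)]
  have h1 := hK (m - k) m (Nat.sub_le _ _)
  have h2 : R ^ m = R ^ (m - k) * R ^ k := by rw [← pow_add]; congr 1; omega
  simp only [h2] at h1
  have h3 : 0 < R ^ (m - k) := pow_pos hR _
  have : e (m-k) * R ^ (m-k) ≤ (K * R ^ k * e m) * R ^ (m-k) := by
    calc _ ≤ _ := h1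
      _ = _ := by ring
  exact le_of_mul_le_mul_right this h3

lemma RefSeq.lim_k (he : RefSeq e ρ R) (k : ℕ) :
    Tendsto (fun m => e (m - k) / e m) atTop (𝓝 (ρ ^ k)) := by
  rw [← tendsto_add_atTop_iff_nat k]
  simp only [Nat.add_sub_cancel]
  induction k with
  | zero =>
    have : (fun n => e n / e (n + 0)) = fun _ => (1:ℝ) := by
      funext m; exact div_self (he.pos m).ne'
    rw [this]; simp
  | succ k ih =>
    have h1 := he.lim.comp (tendsto_add_atTop_nat k)
    have := ih.mul h1
    rw [pow_succ]
    refine this.congr fun m => ?_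
    have a := (he.pos (m+k)).ne'
    have b := (he.pos (m+k+1)).ne'
    simp only [Function.comp, ← add_assoc]
    field_simp

lemma Good.summable_ev (he : RefSeq e ρ R) {r : PowerSeries ℝ} (hr : Good R r) :
    Summable fun k => |coeff k r * ρ ^ k| := by
  refine Summable.of_nonneg_of_le (fun _ => abs_nonneg _) (fun k => ?_) hr
  rw [abs_mul, abs_of_nonneg (pow_nonneg he.rho.le k)]
  gcongr
  exacts [he.rho.le, he.lt.le]

lemma HasL.mul_good (he : RefSeq e ρ R) {r f : PowerSeries ℝ} {L : ℝ} (hr : Good R r)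
    (hf : HasL e f L) : HasL e (r * f) (ev ρ r * L) := by
  obtain ⟨K, hK0, hK⟩ := he.bound
  obtain ⟨K', hK'⟩ : ∃ K', ∀ m, |coeff m f / e m| ≤ K' := by
    obtain ⟨K', hK'⟩ := (Metric.isBounded_range_of_tendsto _ hf).exists_norm_le
    exact ⟨K', fun m => by
      have := hK' _ ⟨m, rfl⟩
      rwa [Real.norm_eq_abs] at this⟩
  have hK'0 : 0 ≤ K' := (abs_nonneg _).trans (hK' 0)
  have key : Tendsto (fun m => ∑' k, if k ≤ m then coeff k r * (coeff (m - k) f / e m) else 0)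
      atTop (𝓝 (∑' k, coeff k r * (L * ρ ^ k))) := by
    refine tendsto_tsum_of_dominated_convergence
      (bound := fun k => (K' * K) * (|coeff k r| * R ^ k)) (Summable.mul_left _ hr) ?_ ?_
    · intro k
      have h1 : Tendsto (fun m => coeff (m - k) f / e (m - k)) atTop (𝓝 L) :=
        hf.comp (tendsto_sub_atTop_nat k)
      have h2 := (h1.mul (he.lim_k k)).const_mul (coeff k r)
      refine h2.congr' ?_
      filter_upwards [eventually_ge_atTop k] with m hm
      rw [if_pos hm]
      have a := (he.pos (m-k)).ne'
      field_simp
    · refine Eventually.of_forall fun m k => ?_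
      split_ifs with hkm
      · rw [norm_mul, Real.norm_eq_abs, Real.norm_eq_abs]
        have a := (he.pos (m-k)).ne'
        have : coeff (m - k) f / e m = coeff (m - k) f / e (m-k) * (e (m-k) / e m) := by
          field_simp
        rw [this, abs_mul, abs_of_pos (div_pos (he.pos _) (he.pos m))]
        have h3 : |coeff (m - k) f / e (m-k)| * (e (m-k) / e m) ≤ K' * (K * R ^ k) := by
          gcongr
          · exact (div_pos (he.pos _) (he.pos m)).le
          · exact hK' _
          · exact hK m k hkm
        calc _ ≤ |coeff k r| * (K' * (K * R ^ k)) := by gcongr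
          _ = _ := by ring
      · simp only [norm_zero]
        have hR : 0 < R := he.rho.trans he.lt
        positivity
  have e1 : (∑' k, coeff k r * (L * ρ ^ k)) = ev ρ r * L := by
    rw [ev, ← tsum_mul_right]
    exact tsum_congr fun k => by ring
  rw [e1] at key
  refine key.congr fun m => ?_
  rw [tsum_eq_sum (s := Finset.range (m+1)) (fun k hk => if_neg (by simpa using hk))]
  rw [coeff_mul, Finset.Nat.sum_antidiagonal_eq_sum_range_succ
    (fun i j => coeff i r * coeff j f), Finset.sum_div]
  refine Finset.sum_congr rfl fun k hk => ?_
  rw [if_pos (by simp at hk; omega), mul_div_assoc]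

lemma HasL.add {f g : PowerSeries ℝ} {L M : ℝ} (hf : HasL e f L) (hg : HasL e g M) :
    HasL e (f + g) (L + M) := by
  have := Tendsto.add hf hg
  refine this.congr fun m => ?_
  simp [add_div]

lemma HasL.sub {f g : PowerSeries ℝ} {L M : ℝ} (hf : HasL e f L) (hg : HasL e g M) :
    HasL e (f - g) (L - M) := by
  have := Tendsto.sub hf hg
  refine this.congr fun m => ?_
  simp [sub_div]

lemma HasL.smul {f : PowerSeries ℝ} {L : ℝ} (a : ℝ) (hf : HasL e f L) :
    HasL e (C a * f) (a * L) := by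
  have := Tendsto.const_mul a hf
  refine this.congr fun m => ?_
  simp [mul_div_assoc]

lemma HasL.sum {ι : Type*} (s : Finset ι) {f : ι → PowerSeries ℝ} {L : ι → ℝ}
    (hf : ∀ i ∈ s, HasL e (f i) (L i)) : HasL e (∑ i ∈ s, f i) (∑ i ∈ s, L i) := by
  have := tendsto_finsetSum s hf
  refine this.congr fun m => ?_
  simp [Finset.sum_div]

lemma HasL.unique {f : PowerSeries ℝ} {L M : ℝ} (hf : HasL e f L) (hg : HasL e f M) : L = M :=
  tendsto_nhds_unique hf hg

/-- a polynomial-like series (eventually vanishing coefficients) has limit `0`. -/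
lemma HasL.zero_of_eventually {f : PowerSeries ℝ} (hf : ∀ m, 3 ≤ m → coeff m f = 0) :
    HasL e f 0 := by
  refine tendsto_const_nhds.congr' ?_
  filter_upwards [eventually_ge_atTop 3] with m hm
  simp [hf m hm]

/-- quadratic polynomial as power series -/
noncomputable def quad (a b c : ℝ) : PowerSeries ℝ := C a + C b * X + C c * X ^ 2

lemma HasL.quad0 (a b c : ℝ) : HasL e (quad a b c) 0 := by
  refine HasL.zero_of_eventually fun m hm => ?_
  obtain ⟨k, rfl⟩ : ∃ k, m = k + 3 := ⟨m - 3, by omega⟩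
  simp [quad, coeff_X_pow]

lemma HasL.X_mul (he : RefSeq e ρ R) {f : PowerSeries ℝ} {L : ℝ} (hf : HasL e f L) :
    HasL e (X * f) (ρ * L) := by
  unfold HasL
  rw [← tendsto_add_atTop_iff_nat 1]
  have h := Tendsto.mul he.lim hf
  refine h.congr fun m => ?_
  rw [coeff_succ_X_mul]
  have a := (he.pos m).ne'
  field_simp

lemma HasL.quad_mul (he : RefSeq e ρ R) (a b c : ℝ) {f : PowerSeries ℝ} {L : ℝ}
    (hf : HasL e f L) : HasL e (quad a b c * f) ((a + b * ρ + c * ρ ^ 2) * L) := by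
  have h1 := hf.X_mul he
  have h2 := h1.X_mul he
  have := ((hf.smul a).add (h1.smul b)).add (h2.smul c)
  convert! this using 1
  · rw [quad]; ring
  · ring

lemma good_of_bound {lam K : ℝ} (hlam : 0 ≤ lam) (hR : 0 < R) (h1 : lam * R < 1)
    {r : PowerSeries ℝ} (hr : ∀ k, |coeff k r| ≤ K * lam ^ k) : Good R r := by
  refine Summable.of_nonneg_of_le (fun k => by positivity) (fun k => ?_)
    ((summable_geometric_of_lt_one (by positivity) h1).mul_left K)
  calc |coeff k r| * R ^ k ≤ K * lam ^ k * R ^ k := by gcongr; exact hr k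
    _ = _ := by rw [mul_pow]; ring

/-- inverse of a quadratic -/
lemma exists_inv_quad {lam : ℝ} (hlam : 0 < lam) (hR : 0 < R) (h1 : lam * R < 1)
    {a b c : ℝ} (ha : 0 < a) (h : |b| * lam + |c| ≤ a * lam ^ 2) :
    ∃ w, Good R w ∧ w * quad a b c = 1 := by
  have hc : constantCoeff (quad a b c) ≠ 0 := by simp [quad, ha.ne']
  have hw : (quad a b c)⁻¹ * quad a b c = 1 := PowerSeries.inv_mul_cancel _ hc
  refine ⟨(quad a b c)⁻¹, ?_, hw⟩
  set w := (quad a b c)⁻¹ with hwdef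
  refine good_of_bound (lam := lam) (K := 1 / a) hlam.le hR h1 ?_
  have hexp : w * quad a b c = C a * w + C b * (X * w) + C c * (X * (X * w)) := by
    rw [quad]; ring
  rw [hexp] at hw
  have c0 : a * coeff 0 w = 1 := by
    have := congrArg (coeff 0) hw
    simpa using this
  have c1 : a * coeff 1 w + b * coeff 0 w = 0 := by
    have := congrArg (coeff 1) hw
    simp only [map_add, coeff_C_mul, coeff_one] at this
    rw [show (1:ℕ) = 0 + 1 from rfl, coeff_succ_X_mul, coeff_succ_X_mul, coeff_zero_X_mul] at this
    simpa using this
  have c2 : ∀ k, a * coeff (k+2) w + b * coeff (k+1) w + c * coeff k w = 0 := by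
    intro k
    have := congrArg (coeff (k+2)) hw
    simp only [map_add, coeff_C_mul, coeff_one] at this
    rw [show k + 2 = k + 1 + 1 from rfl, coeff_succ_X_mul, coeff_succ_X_mul,
      coeff_succ_X_mul] at this
    simpa using this
  have habs : ∀ x : ℝ, |x| = |a * x| / a := fun x => by
    rw [abs_mul, abs_of_pos ha]; field_simp
  have hb : |b| ≤ a * lam := by
    have : |b| * lam ≤ a * lam * lam := by nlinarith [abs_nonneg c]
    exact le_of_mul_le_mul_right this hlam
  have H : ∀ k, |coeff k w| ≤ 1 / a * lam ^ k ∧ |coeff (k+1) w| ≤ 1 / a * lam ^ (k+1) := by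
    intro k
    induction k with
    | zero =>
      have h0 : coeff 0 w = 1 / a := by field_simp; linarith
      have hh : |coeff 0 w| = 1 / a := by rw [h0, abs_of_pos (by positivity)]
      refine ⟨by rw [hh]; simp, ?_⟩
      rw [zero_add, habs, show a * coeff 1 w = - (b * coeff 0 w) by linarith, abs_neg, abs_mul, hh,
        pow_one, div_le_iff₀ ha]
      calc |b| * (1 / a) ≤ a * lam * (1 / a) := by gcongr
        _ = _ := by ring
    | succ k ih =>
      refine ⟨ih.2, ?_⟩
      rw [habs, show a * coeff (k + 1 + 1) w = - (b * coeff (k+1) w + c * coeff k w) by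
        linarith [c2 k], abs_neg, div_le_iff₀ ha]
      calc |b * coeff (k+1) w + c * coeff k w|
          ≤ |b| * |coeff (k+1) w| + |c| * |coeff k w| := by
            rw [← abs_mul, ← abs_mul]; exact abs_add_le _ _
        _ ≤ |b| * (1 / a * lam ^ (k+1)) + |c| * (1 / a * lam ^ k) := by
            gcongr
            exacts [ih.2, ih.1]
        _ = (|b| * lam + |c|) * (1 / a * lam ^ k) := by ring
        _ ≤ (a * lam ^ 2) * (1 / a * lam ^ k) := by gcongr
        _ = _ := by ring
  exact fun k => (H k).1

/-- scaled Catalan series -/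
noncomputable def catS (t : ℝ) : PowerSeries ℝ := PowerSeries.mk fun k => (catalan k : ℝ) * (t / 4) ^ k

lemma catS_eq (t : ℝ) : catS t = 1 + C (t / 4) * (X * catS t ^ 2) := by
  ext m
  cases m with
  | zero => simp [catS]
  | succ m =>
    rw [map_add, coeff_C_mul, coeff_succ_X_mul, sq, coeff_mul]
    simp only [catS, coeff_mk, catalan_succ', coeff_one]
    push_cast
    rw [zero_add, Finset.sum_mul, Finset.mul_sum]
    refine Finset.sum_congr rfl fun p hp => ?_
    rw [← (Finset.HasAntidiagonal.mem_antidiagonal.1 hp)]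
    ring

/-- square root of `1 - t X` -/
noncomputable def sqS (t : ℝ) : PowerSeries ℝ := 1 - C (t / 2) * (X * catS t)

lemma sqS_sq (t : ℝ) : sqS t ^ 2 = 1 - C t * X := by
  have h := catS_eq t
  have e1 : sqS t ^ 2 = 1 - 2 * C (t/2) * (X * catS t) + C (t/2) ^ 2 * (X * (X * catS t ^ 2)) := by
    rw [sqS]; ring
  have h2 : (2 : PowerSeries ℝ) * C (t / 2) = C t := by
    rw [show (2 : PowerSeries ℝ) = C 2 from (map_ofNat C 2).symm, ← map_mul]; congr 1; ring
  have h3 : (C (t / 2) : PowerSeries ℝ) ^ 2 = C t * C (t / 4) := by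
    rw [← map_pow, ← map_mul]; congr 1; ring
  rw [e1, h2, h3]
  linear_combination (-C t * X) * h

lemma catalan_le (k : ℕ) : catalan k ≤ 4 ^ k := by
  rw [catalan_eq_centralBinom_div]
  exact (Nat.div_le_self _ _).trans (Nat.centralBinom_le_four_pow k)

lemma good_sqS {t : ℝ} (hR : 0 < R) (h : |t| * R < 1) : Good R (sqS t) := by
  refine good_of_bound (lam := |t|) (K := 1) (abs_nonneg t) hR h fun k => ?_
  cases k with
  | zero => simp [sqS]
  | succ k =>
    rw [sqS, map_sub, coeff_one, if_neg (by omega), coeff_C_mul, coeff_succ_X_mul, catS, coeff_mk,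
      zero_sub, abs_neg, abs_mul, abs_mul, abs_pow, Nat.abs_cast, abs_div, abs_div]
    have : (catalan k : ℝ) ≤ 4 ^ k := by exact_mod_cast catalan_le k
    rw [abs_of_pos (by norm_num : (0:ℝ) < 2), abs_of_pos (by norm_num : (0:ℝ) < 4)]
    calc |t| / 2 * (catalan k * (|t| / 4) ^ k) ≤ |t| / 2 * (4 ^ k * (|t| / 4) ^ k) := by gcongr
      _ = |t| ^ (k+1) / 2 := by rw [← mul_pow, mul_div_cancel₀ _ (by norm_num)]; ring
      _ ≤ _ := by have := pow_nonneg (abs_nonneg t) (k+1); linarith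

lemma catalan_rec (m : ℕ) : ((m:ℝ) + 2) * catalan (m+1) = 2 * (2 * m + 1) * catalan m := by
  have h1 := succ_mul_catalan_eq_centralBinom m
  have h2 := succ_mul_catalan_eq_centralBinom (m+1)
  have h3 := Nat.succ_mul_centralBinom_succ m
  rw [← h1, ← h2] at h3
  have h4 : ((m + 1 + 1) * catalan (m+1)) = 2 * (2 * m + 1) * catalan m := by
    apply Nat.eq_of_mul_eq_mul_left (Nat.succ_pos m)
    simp only [Nat.succ_eq_add_one]
    rw [h3]; ring
  have := congrArg (Nat.cast (R := ℝ)) h4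
  push_cast at this
  linarith

lemma catalan_pos' (m : ℕ) : (0:ℝ) < catalan m := by
  have := succ_mul_catalan_eq_centralBinom m
  have h2 := Nat.centralBinom_pos m
  rw [← this] at h2
  exact_mod_cast Nat.pos_of_mul_pos_left h2

lemma refSeq_cat {t : ℝ} (ht : 0 < t) (hR : 1 / t < R) :
    RefSeq (fun m => (catalan m : ℝ) * (t / 4) ^ m) (1 / t) R := by
  refine ⟨fun m => mul_pos (catalan_pos' m) (by positivity), by positivity, hR, ?_⟩
  have h : Tendsto (fun m : ℕ => (1 / t) * (1 + (3/2) / ((m:ℝ) + 1/2))) atTop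
      (𝓝 ((1/t) * (1 + 0))) := by
    refine Tendsto.const_mul _ (Tendsto.const_add _ ?_)
    refine Tendsto.div_atTop tendsto_const_nhds ?_
    exact tendsto_atTop_add_const_right _ _ tendsto_natCast_atTop_atTop
  rw [add_zero, mul_one] at h
  refine h.congr fun m => ?_
  have h1 := catalan_rec m
  have p1 := (catalan_pos' m).ne'
  have p2 := (catalan_pos' (m+1)).ne'
  have hm : (2 * (m:ℝ) + 1) ≠ 0 := by positivity
  have e1 : (catalan m : ℝ) = (m + 2) * catalan (m+1) / (2 * (2 * m + 1)) := by
    field_simp; linarith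
  rw [e1, pow_succ]
  have hm2 : ((m:ℝ) + 1/2) ≠ 0 := by positivity
  field_simp
  ring

end Analytic
section Core
open Filter Topology PowerSeries

lemma core_limit {r : ℝ} (hr : 1 ≤ r) (hl : 2 ≤ r ^ 2) {B V : PowerSeries ℝ}
    (hV : V * (1 - B) = 1) (hB : B = C (r ^ 2) * X + X * (V - 1 - B)) :
    ∃ (e : ℕ → ℝ) (β : ℝ), RefSeq e (1 / (r ^ 2 + 2 * r)) (1 / (r ^ 2 + r)) ∧ β ≠ 0 ∧ HasL e B β ∧
      ∀ (c : ℝ) (W : PowerSeries ℝ), 0 ≤ c → c ≤ r ^ 2 → W * (1 - B + C c * X) = 1 →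
        HasL e (X * W) (β * (1 + 1 / (r ^ 2 + 2 * r)) /
          (1 + (r + 1) / (r ^ 2 + 2 * r) * c) ^ 2) := by
  have hr0 : 0 < r := by linarith
  set τ := r ^ 2 + 2 * r with hτ
  have hτ0 : 0 < τ := by positivity
  set σ := r ^ 2 - 2 * r with hσ
  set R := 1 / (r ^ 2 + r) with hRdef
  have hR0 : 0 < R := by positivity
  have hlt : 1 / τ < R := by
    rw [hRdef]; apply one_div_lt_one_div_of_lt (by positivity); rw [hτ]; linarith
  have he := refSeq_cat hτ0 hlt
  set e : ℕ → ℝ := fun m => (catalan m : ℝ) * (τ / 4) ^ m with hedef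
  set ρ := 1 / τ with hρ
  have hρτ : ρ * τ = 1 := by rw [hρ]; field_simp
  have hρ0 : 0 < ρ := he.rho
  have hE : HasL e (catS τ) 1 := by
    refine tendsto_const_nhds.congr fun m => ?_
    simp only [catS, coeff_mk]
    exact (div_self (he.pos m).ne').symm
  -- quadratic equation
  have hquad : (1 + X) * B ^ 2 - (1 + C (r^2) * X) * B + C (r^2) * X = 0 := by
    linear_combination (B - 1) * hB - X * hV
  have hCr : (C (r ^ 2) : PowerSeries ℝ) = C r ^ 2 := map_pow _ _ _
  have hCτ : (C τ : PowerSeries ℝ) = C r ^ 2 + 2 * C r := by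
    rw [hτ, map_add, map_mul, map_pow]; rfl
  have hCσ : (C σ : PowerSeries ℝ) = C r ^ 2 - 2 * C r := by
    rw [hσ, map_sub, map_mul, map_pow]; rfl
  have hsq : (2 * (1 + X) * B - (1 + C (r^2) * X)) ^ 2 = (sqS τ * sqS σ) ^ 2 := by
    rw [mul_pow, sqS_sq, sqS_sq, hCτ, hCσ]
    rw [hCr] at hquad ⊢
    linear_combination 4 * (1 + X) * hquad
  have hB0 : constantCoeff B = 0 := by
    have := congrArg constantCoeff hB
    simpa using this
  have hD : 2 * (1 + X) * B - (1 + C (r^2) * X) = - (sqS τ * sqS σ) := by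
    rcases sq_eq_sq_iff_eq_or_eq_neg.1 hsq with h | h
    · exfalso
      have := congrArg constantCoeff h
      simp [sqS, hB0] at this
      norm_num at this
    · exact h
  -- limits
  have hlamR : r ^ 2 * R < 1 := by
    rw [hRdef, mul_one_div, div_lt_one (by positivity)]; linarith
  have hσR : |σ| * R < 1 := by
    rw [hRdef, mul_one_div, div_lt_one (by positivity), abs_lt, hσ]
    constructor <;> nlinarith
  have hgσ : Good R (sqS σ) := good_sqS hR0 hσR
  set s := ev ρ (sqS σ) with hs
  have hss : s * (s * 1) = (1 + (-σ) * ρ + 0 * ρ ^ 2) * 1 := by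
    have h1 := (hE.mul_good he hgσ).mul_good he hgσ
    have h2 := hE.quad_mul he 1 (-σ) 0
    have : sqS σ * (sqS σ * catS τ) = quad 1 (-σ) 0 * catS τ := by
      rw [← mul_assoc, ← sq, sqS_sq, quad]; simp [sub_eq_add_neg]
    rw [this] at h1
    exact h1.unique h2
  have hs0 : s ≠ 0 := by
    rintro h
    rw [h] at hss
    have : σ * ρ = 1 := by linarith
    have h3 : σ = τ := by
      have : σ * ρ = τ * ρ := by linarith
      exact mul_right_cancel₀ hρ0.ne' this
    rw [hσ, hτ] at h3; linarith
  have hτl : HasL e (sqS τ) (-(1/2)) := by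
    have h1 := (HasL.quad0 (e := e) 1 0 0).sub ((hE.X_mul he).smul (τ / 2))
    convert! h1 using 1
    · simp [sqS, quad]
    · rw [mul_one, zero_sub, div_mul_eq_mul_div, mul_comm, hρτ]
  have h2B : HasL e (quad 1 1 0 * B) (1/4 * s) := by
    have h1 := ((HasL.quad0 (e := e) 1 (r^2) 0).sub (hτl.mul_good he hgσ)).smul (1/2)
    convert! h1 using 1
    · have : (C (1/2) : PowerSeries ℝ) * 2 = 1 := by
        rw [show (2 : PowerSeries ℝ) = C 2 from (map_ofNat C 2).symm, ← map_mul]; norm_num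
      simp only [quad, map_one, map_zero]
      linear_combination (C (1/2)) * hD - (1 + X) * B * this
    · ring
  obtain ⟨u, hu, hu1⟩ := exists_inv_quad (R := R) (lam := r^2) (a := 1) (b := 1) (c := 0)
    (by positivity) hR0 hlamR one_pos (by simp; nlinarith)
  have hBl : HasL e B (ev ρ u * (1/4 * s)) := by
    have := h2B.mul_good he hu
    rwa [← mul_assoc, hu1, one_mul] at this
  have hu0 : ev ρ u * ((1 + 1 * ρ + 0 * ρ ^ 2) * 1) = 1 := by
    have := (hE.quad_mul he 1 1 0).mul_good he hu
    rw [← mul_assoc, hu1, one_mul] at this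
    exact this.unique hE
  have hu0' : ev ρ u ≠ 0 := by
    intro h; rw [h] at hu0; simp at hu0
  refine ⟨e, ev ρ u * (1/4 * s), he, by simp [hu0', hs0], hBl, ?_⟩
  set β := ev ρ u * (1/4 * s)
  intro c W hc0 hc1 hW
  obtain ⟨w, hw, hw1⟩ := exists_inv_quad (R := R) (lam := r^2) (a := c + 1)
    (b := c * (c + 2 - r^2)) (c := c^2)
    (by positivity) hR0 hlamR (by linarith) (by
      rw [abs_of_nonneg (sq_nonneg c), abs_mul, abs_of_nonneg hc0]
      rcases abs_cases (c + 2 - r^2) with ⟨h, _⟩ | ⟨h, _⟩ <;> rw [h]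
      · set l := r ^ 2
        nlinarith [mul_nonneg hc0 (sub_nonneg.2 hc1), mul_nonneg (sub_nonneg.2 hc1) (sub_nonneg.2 hl), mul_nonneg hc0 (sub_nonneg.2 hl), mul_nonneg (mul_nonneg hc0 (sub_nonneg.2 hc1)) (sub_nonneg.2 hl)]
      · set l := r ^ 2
        nlinarith [mul_nonneg hc0 (sub_nonneg.2 hc1), mul_nonneg (mul_nonneg hc0 hc0) (sub_nonneg.2 hl), mul_nonneg hc0 (sub_nonneg.2 hl)])
  have hXW : X * W = w * (quad 0 (c + 1 - r^2) c + quad 1 1 0 * B) := by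
    have hq : (1 - B + C c * X) * (quad 0 (c + 1 - r^2) c + quad 1 1 0 * B)
        = X * quad (c+1) (c * (c + 2 - r^2)) (c^2) := by
      simp only [quad, map_one, map_zero, map_add, map_sub, map_mul, map_pow]
      rw [show (C 2 : PowerSeries ℝ) = 2 from map_ofNat C 2]
      rw [hCr] at hquad
      linear_combination -hquad
    calc X * W = X * W * (w * quad (c+1) (c * (c + 2 - r^2)) (c^2)) := by rw [hw1, mul_one]
      _ = W * w * (X * quad (c+1) (c * (c + 2 - r^2)) (c^2)) := by ring
      _ = (W * (1 - B + C c * X)) * (w * (quad 0 (c + 1 - r^2) c + quad 1 1 0 * B)) := by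
        rw [← hq]; ring
      _ = _ := by rw [hW, one_mul]
  have hw0 : ev ρ w * (((c+1) + (c * (c + 2 - r^2)) * ρ + c^2 * ρ ^ 2) * 1) = 1 := by
    have := (hE.quad_mul he (c+1) (c * (c + 2 - r^2)) (c^2)).mul_good he hw
    rw [← mul_assoc, hw1, one_mul] at this
    exact this.unique hE
  have hl := ((HasL.quad0 (e := e) 0 (c+1-r^2) c).add (hBl.quad_mul he 1 1 0)).mul_good he hw
  rw [← hXW] at hl
  convert! hl using 1
  have hk : (r + 1) / τ = (r + 1) * ρ := by rw [hρ]; ring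
  have hkc : (1 + (r+1)/τ * c)^2 = (c+1) + (c * (c + 2 - r^2)) * ρ + c^2 * ρ ^ 2 := by
    rw [hk]
    have h1 : ρ * (r^2 + 2 * r) = 1 := hρτ
    linear_combination (c + c^2 * ρ) * h1
  rw [hkc]
  rw [mul_one] at hw0
  have hne : (c+1) + (c * (c + 2 - r^2)) * ρ + c^2 * ρ ^ 2 ≠ 0 := by
    intro h; rw [h] at hw0; simp at hw0
  rw [div_eq_iff hne]
  linear_combination (-(β * (1 + ρ))) * hw0

end Core
section Combi
open PowerSeries

namespace AT

variable {n : ℕ}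

lemma size_pos (t : AT n) : 1 ≤ size t := by
  cases t <;> simp [size]

lemma length_le_sizeList (ts : List (AT n)) : ts.length ≤ sizeList ts := by
  induction ts with
  | nil => simp [sizeList]
  | cons t ts ih => simp only [sizeList, List.length_cons]; have := size_pos t; omega

lemma size_le_sizeList (ts : List (AT n)) : ∀ t ∈ ts, size t ≤ sizeList ts := by
  induction ts with
  | nil => simp
  | cons t ts ih =>
    intro u hu
    simp only [sizeList]
    rcases List.mem_cons.1 hu with h | h
    · subst h; omega
    · have := ih u h; omega

lemma finite_size_le (m : ℕ) : {t : AT n | size t ≤ m}.Finite := by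
  induction m with
  | zero =>
    convert! Set.finite_empty
    ext t
    have := size_pos t
    simp; omega
  | succ m ih =>
    have hf : Finite {t : AT n | size t ≤ m} := ih
    have hl := List.finite_length_le {t : AT n | size t ≤ m} m
    refine (((Set.finite_range (fun p : Fin n × Bool => AT.leaf p.1 p.2)).union
      ((hl.image (fun l => AT.node true (l.map Subtype.val))).union
       (hl.image (fun l => AT.node false (l.map Subtype.val)))))).subset ?_
    intro t ht
    cases t with
    | leaf i b => exact Or.inl ⟨(i, b), rfl⟩
    | node c ts =>
      right
      simp only [Set.mem_ofPred_eq, size] at ht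
      have h1 := length_le_sizeList ts
      have h2 : ∀ t ∈ ts, size t ≤ m := fun t h => by have := size_le_sizeList ts t h; omega
      have h3 : ∃ l : List {t : AT n | size t ≤ m}, l.length ≤ m ∧ l.map Subtype.val = ts := by
        refine ⟨ts.pmap Subtype.mk h2, ?_, ?_⟩
        · simp; omega
        · simp [List.map_pmap]
      obtain ⟨l, hl1, hl2⟩ := h3
      cases c with
      | true => exact Or.inl ⟨l, hl1, by rw [← hl2]⟩
      | false => exact Or.inr ⟨l, hl1, by rw [← hl2]⟩

lemma finite_size (m : ℕ) : {t : AT n | size t = m}.Finite :=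
  (finite_size_le m).subset fun _ h => le_of_eq h

lemma finite_sizeList (m : ℕ) : {ts : List (AT n) | sizeList ts = m}.Finite := by
  have := (finite_size (n := n) (1 + m)).preimage (f := AT.node true) (fun a _ b _ h => by
    simpa using h)
  refine this.subset fun ts h => ?_
  simp only [Set.mem_ofPred_eq] at h
  simp [size, h]

end AT

open AT

/-- number of trees of size `m` with property `p` -/
noncomputable def cl {n : ℕ} (p : AT n → Prop) (m : ℕ) : ℕ := Nat.card {t : AT n // p t ∧ size t = m}

/-- number of lists of trees with property `p` of total size `m` -/
noncomputable def ll {n : ℕ} (p : AT n → Prop) (m : ℕ) : ℕ :=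
  Nat.card {ts : List (AT n) // (∀ t ∈ ts, p t) ∧ sizeList ts = m}

instance finite_cl {n : ℕ} (p : AT n → Prop) (m : ℕ) : Finite {t : AT n // p t ∧ size t = m} :=
  ((finite_size m).subset fun _ h => h.2 : {t : AT n | p t ∧ size t = m}.Finite)

instance finite_ll {n : ℕ} (p : List (AT n) → Prop) (m : ℕ) :
    Finite {ts : List (AT n) // p ts ∧ sizeList ts = m} :=
  ((finite_sizeList m).subset fun _ h => h.2 :
    {ts : List (AT n) | p ts ∧ sizeList ts = m}.Finite)

/-- generating function of trees -/
noncomputable def clS {n : ℕ} (p : AT n → Prop) : PowerSeries ℝ := PowerSeries.mk fun m => (cl p m : ℝ)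

/-- generating function of lists -/
noncomputable def llS {n : ℕ} (p : AT n → Prop) : PowerSeries ℝ := PowerSeries.mk fun m => (ll p m : ℝ)

variable {n : ℕ}

/-- first-element decomposition -/
def consEquiv (p : AT n → Prop) (m : ℕ) :
    {ts : List (AT n) // (∀ t ∈ ts, p t) ∧ sizeList ts = m + 1} ≃
    (Σ k : Finset.HasAntidiagonal.antidiagonal (m + 1), {t : AT n // p t ∧ size t = k.1.1} ×
      {ts : List (AT n) // (∀ t ∈ ts, p t) ∧ sizeList ts = k.1.2}) where
  toFun := fun x => match x with
    | ⟨[], h⟩ => absurd h.2 (by simp [sizeList])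
    | ⟨t :: ts, h⟩ => ⟨⟨(size t, sizeList ts), by
        simpa [sizeList] using h.2⟩, ⟨t, h.1 t (by simp), rfl⟩,
        ⟨ts, fun u hu => h.1 u (by simp [hu]), rfl⟩⟩
  invFun := fun y => ⟨y.2.1.1 :: y.2.2.1, by
    obtain ⟨⟨k, hk⟩, ⟨t, ht, ht2⟩, ⟨ts, hts, hts2⟩⟩ := y
    refine ⟨?_, ?_⟩
    · intro u hu
      rcases List.mem_cons.1 hu with h | h
      · rw [h]; exact ht
      · exact hts u h
    · simp only [sizeList]
      rw [ht2, hts2]; simpa using hk⟩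
  left_inv := fun x => by
    match x with
    | ⟨[], h⟩ => exact absurd h.2 (by simp [sizeList])
    | ⟨t :: ts, h⟩ => rfl
  right_inv := by
    rintro ⟨⟨⟨k1, k2⟩, hk⟩, ⟨t, ht, (rfl : size t = k1)⟩, ⟨ts, hts, (rfl : sizeList ts = k2)⟩⟩
    rfl

lemma cl_zero (p : AT n → Prop) : cl p 0 = 0 := by
  have : IsEmpty {t : AT n // p t ∧ size t = 0} := ⟨fun x => by
    have := size_pos x.1; have := x.2.2; omega⟩
  simp [cl]

lemma ll_zero (p : AT n → Prop) : ll p 0 = 1 := by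
  rw [ll, Nat.card_eq_one_iff_unique]
  refine ⟨⟨fun a b => ?_⟩, ⟨⟨[], by simp [sizeList]⟩⟩⟩
  have h : ∀ ts : List (AT n), sizeList ts = 0 → ts = [] := fun ts h => by
    have := length_le_sizeList ts
    exact List.length_eq_zero_iff.1 (by omega)
  exact Subtype.ext ((h _ a.2.2).trans (h _ b.2.2).symm)

lemma ll_succ (p : AT n → Prop) (m : ℕ) :
    ll p (m+1) = ∑ k ∈ Finset.HasAntidiagonal.antidiagonal (m+1), cl p k.1 * ll p k.2 := by
  rw [ll, Nat.card_congr (consEquiv p m), Nat.card_sigma]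
  simp only [Nat.card_prod]
  rw [← Finset.sum_coe_sort (Finset.HasAntidiagonal.antidiagonal (m+1))]
  rfl

lemma llS_mul (p : AT n → Prop) : llS p * (1 - clS p) = 1 := by
  have h : llS p = 1 + clS p * llS p := by
    ext m
    cases m with
    | zero => simp [llS, clS, ll_zero, cl_zero]
    | succ m =>
      rw [map_add, coeff_mul]
      simp only [llS, clS, coeff_mk, coeff_one, ll_succ]
      push_cast
      simp
  linear_combination h

/-- children of a `c`-node -/
def chd (c : Bool) (t : AT n) : Prop := WF t ∧ rootConn t ≠ some c

lemma wf_node_iff (c : Bool) (ts : List (AT n)) :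
    WF (.node c ts) ↔ 2 ≤ ts.length ∧ ∀ t ∈ ts, chd c t := by
  constructor
  · intro h
    cases h with
    | node _ _ h1 h2 h3 => exact ⟨h1, fun t ht => ⟨h2 t ht, h3 t ht⟩⟩
  · rintro ⟨h1, h2⟩
    exact WF.node c ts h1 (fun t ht => (h2 t ht).1) (fun t ht => (h2 t ht).2)

/-- the number of leaves satisfying `q`, as a count of trees -/
lemma cl_leaf (q : Fin n → Bool → Prop) [∀ i b, Decidable (q i b)] :
    clS (fun t : AT n => ∃ i b, q i b ∧ t = .leaf i b) =
      C ((Finset.univ.filter fun p : Fin n × Bool => q p.1 p.2).card : ℝ) * X := by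
  ext m
  rw [clS, coeff_mk, coeff_C_mul, coeff_X, cl]
  split_ifs with hm
  · subst hm
    rw [mul_one]
    norm_cast
    rw [← Fintype.card_coe, ← Nat.card_eq_fintype_card]
    symm
    refine Nat.card_congr (Equiv.ofBijective (fun p => ⟨.leaf p.1.1 p.1.2, ⟨p.1.1, p.1.2, by
      have := p.2
      rw [Finset.mem_filter] at this
      exact this.2, rfl⟩, by simp [size]⟩) ⟨?_, ?_⟩)
    · rintro ⟨⟨i, b⟩, h⟩ ⟨⟨j, b'⟩, h'⟩ hh
      simpa using hh
    · rintro ⟨t, ⟨i, b, hq, rfl⟩, h⟩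
      exact ⟨⟨(i, b), by simpa using hq⟩, rfl⟩
  · rw [mul_zero]
    have : IsEmpty {t : AT n // (∃ i b, q i b ∧ t = .leaf i b) ∧ size t = m} := ⟨by
      rintro ⟨t, ⟨i, b, hq, rfl⟩, h⟩
      simp [size] at h
      omega⟩
    rw [Nat.card_of_isEmpty, Nat.cast_zero]

lemma clS_or (p q : AT n → Prop) (h : ∀ t, p t → ¬ q t) :
    clS (fun t => p t ∨ q t) = clS p + clS q := by
  ext m
  simp only [clS, coeff_mk, map_add]
  norm_cast
  unfold cl
  have e1 : {t : AT n | (p t ∨ q t) ∧ size t = m} = {t | p t ∧ size t = m} ∪ {t | q t ∧ size t = m} := by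
    ext t; simp; tauto
  have h2 := Set.ncard_union_eq (s := {t : AT n | p t ∧ size t = m}) (t := {t | q t ∧ size t = m})
    (Set.disjoint_left.2 fun t h1 h2 => h t h1.1 h2.1) (finite_cl p m) (finite_cl q m)
  rw [← e1] at h2
  exact h2

lemma clS_congr {p q : AT n → Prop} (h : ∀ t, p t ↔ q t) : clS p = clS q := by
  have : p = q := funext fun t => propext (h t)
  rw [this]

/-- counting internal nodes through lists of children -/
lemma cl_node (c : Bool) (Q : List (AT n) → Prop) (m : ℕ) :
    cl (fun t : AT n => ∃ ts, Q ts ∧ t = .node c ts) (m+1) =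
      Nat.card {ts : List (AT n) // Q ts ∧ sizeList ts = m} := by
  symm
  refine Nat.card_congr (Equiv.ofBijective (fun ts => ⟨.node c ts.1, ⟨ts.1, ts.2.1, rfl⟩, by
      have := ts.2.2
      simp [size]; omega⟩) ⟨?_, ?_⟩)
  · rintro ⟨a, h⟩ ⟨b, h'⟩ hh
    simpa using hh
  · rintro ⟨t, ⟨ts, hq, rfl⟩, h⟩
    exact ⟨⟨ts, hq, by simp [size] at h; omega⟩, rfl⟩

lemma ll_split (p : AT n → Prop) (m : ℕ) :
    (ll p m : ℝ) = (Nat.card {ts : List (AT n) // (2 ≤ ts.length ∧ ∀ t ∈ ts, p t) ∧ sizeList ts = m} : ℝ)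
      + cl p m + if m = 0 then 1 else 0 := by
  have h1 : (cl p m : ℕ) =
      {ts : List (AT n) | (ts.length = 1 ∧ ∀ t ∈ ts, p t) ∧ sizeList ts = m}.ncard := by
    refine Nat.card_congr (Equiv.ofBijective (fun t => ⟨[t.1], ⟨⟨rfl, by simpa using t.2.1⟩, by
      simpa [sizeList] using t.2.2⟩⟩) ⟨?_, ?_⟩)
    · rintro ⟨a, h⟩ ⟨b, h'⟩ hh
      simpa using hh
    · rintro ⟨ts, ⟨⟨h1, h2⟩, h3⟩⟩
      obtain ⟨t, rfl⟩ := List.length_eq_one_iff.1 h1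
      exact ⟨⟨t, h2 t (by simp), by simpa [sizeList] using h3⟩, rfl⟩
  have h0 : {ts : List (AT n) | (ts.length = 0 ∧ ∀ t ∈ ts, p t) ∧ sizeList ts = m}.ncard =
      if m = 0 then 1 else 0 := by
    split_ifs with hm
    · rw [Set.ncard_eq_one]
      refine ⟨[], ?_⟩
      ext ts
      simp only [Set.mem_ofPred_eq, Set.mem_singleton_iff, List.length_eq_zero_iff]
      constructor
      · exact fun h => h.1.1
      · rintro rfl; simp [sizeList, hm]
    · refine (Set.ncard_eq_zero (finite_ll _ m)).2 ?_
      ext ts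
      simp only [Set.mem_ofPred_eq, Set.mem_empty_iff_false, iff_false, List.length_eq_zero_iff]
      rintro ⟨⟨rfl, _⟩, h⟩
      simp [sizeList] at h; omega
  have e1 : {ts : List (AT n) | (∀ t ∈ ts, p t) ∧ sizeList ts = m} =
     ({ts : List (AT n) | (2 ≤ ts.length ∧ ∀ t ∈ ts, p t) ∧ sizeList ts = m} ∪
     {ts : List (AT n) | (ts.length = 1 ∧ ∀ t ∈ ts, p t) ∧ sizeList ts = m}) ∪
     {ts : List (AT n) | (ts.length = 0 ∧ ∀ t ∈ ts, p t) ∧ sizeList ts = m} := by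
    ext ts
    have : 2 ≤ ts.length ∨ ts.length = 1 ∨ ts.length = 0 := by omega
    simp only [Set.mem_ofPred_eq, Set.mem_union]; tauto
  have h2 := Set.ncard_union_eq (s := {ts : List (AT n) | (2 ≤ ts.length ∧ ∀ t ∈ ts, p t) ∧ sizeList ts = m} ∪
     {ts : List (AT n) | (ts.length = 1 ∧ ∀ t ∈ ts, p t) ∧ sizeList ts = m})
     (t := {ts : List (AT n) | (ts.length = 0 ∧ ∀ t ∈ ts, p t) ∧ sizeList ts = m})
     (Set.disjoint_left.2 fun t h1 h2 => by
        rcases h1 with h1 | h1 <;> have := h1.1.1 <;> have := h2.1.1 <;> omega)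
     (Set.Finite.union (finite_ll _ m) (finite_ll _ m)) (finite_ll _ m)
  have h3 := Set.ncard_union_eq (s := {ts : List (AT n) | (2 ≤ ts.length ∧ ∀ t ∈ ts, p t) ∧ sizeList ts = m})
     (t := {ts : List (AT n) | (ts.length = 1 ∧ ∀ t ∈ ts, p t) ∧ sizeList ts = m})
     (Set.disjoint_left.2 fun t h1 h2 => by
        have := h1.1.1; have := h2.1.1; omega)
     (finite_ll _ m) (finite_ll _ m)
  rw [← e1, h3, h0, ← h1] at h2
  have h4 : ll p m = Nat.card {ts : List (AT n) // (2 ≤ ts.length ∧ ∀ t ∈ ts, p t) ∧ sizeList ts = m}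
      + cl p m + if m = 0 then 1 else 0 := h2
  rw [h4]; push_cast; rfl

lemma clS_wfnode (c : Bool) :
    clS (fun t : AT n => ∃ ts, (2 ≤ ts.length ∧ ∀ t ∈ ts, chd c t) ∧ t = .node c ts) =
      X * (llS (chd (n := n) c) - 1 - clS (chd (n := n) c)) := by
  ext m
  cases m with
  | zero => simp [clS, cl_zero]
  | succ m =>
    rw [coeff_succ_X_mul, clS, coeff_mk, cl_node, map_sub, map_sub, llS, coeff_mk, ll_split,
      clS, coeff_mk, coeff_one]
    ring

lemma card_lits : (((Finset.univ.filter fun _ : Fin n × Bool => True).card : ℕ) : ℝ) = 2 * n := by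
  simp [mul_comm]

lemma clS_chd (c : Bool) :
    clS (chd (n := n) c) = C (2 * n : ℝ) * X + X * (llS (chd (n := n) (!c)) - 1 - clS (chd (n := n) (!c))) := by
  rw [← clS_wfnode, ← card_lits, ← cl_leaf (fun _ _ => True), ← clS_or]
  · refine clS_congr fun t => ?_
    cases t with
    | leaf i b => simp [chd, rootConn, WF.leaf]
    | node d ts => cases d <;> cases c <;> simp [chd, wf_node_iff, rootConn]
  · rintro t ⟨i, b, _, rfl⟩ ⟨ts, _, h⟩
    cases h

lemma clS_chd_symm : clS (chd (n := n) true) = clS (chd (n := n) false) := by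
  have h1 := clS_chd (n := n) true
  have h0 := clS_chd (n := n) false
  have l1 := llS_mul (chd (n := n) true)
  have l0 := llS_mul (chd (n := n) false)
  simp only [Bool.not_true, Bool.not_false] at h1 h0
  set B1 := clS (chd (n := n) true)
  set B0 := clS (chd (n := n) false)
  set V1 := llS (chd (n := n) true)
  set V0 := llS (chd (n := n) false)
  have hV : V1 - V0 = V1 * V0 * (B1 - B0) := by
    linear_combination V1 * (-l0) + V0 * l1
  have h : (B1 - B0) * (1 + X * (V1 * V0 - 1)) = 0 := by
    linear_combination h1 - h0 - X * hV
  rcases mul_eq_zero.1 h with h | h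
  · exact sub_eq_zero.1 h
  · have := congrArg constantCoeff h
    simp at this

lemma clS_all : clS (fun t : AT n => t ∈ (Set.univ : Set (AT n)) ∧ WF t) =
    clS (chd (n := n) false) + clS (chd (n := n) false) - C (2 * n : ℝ) * X := by
  have e1 := clS_chd (n := n) true
  have e2 : clS (fun t : AT n => t ∈ (Set.univ : Set (AT n)) ∧ WF t) = clS (chd (n := n) false) +
     clS (fun t : AT n => ∃ ts, (2 ≤ ts.length ∧ ∀ t ∈ ts, chd false t) ∧ t = .node false ts) := by
    rw [← clS_or]
    · refine clS_congr fun t => ?_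
      cases t with
      | leaf i b => simp [chd, rootConn, WF.leaf]
      | node d ts => cases d <;> simp [chd, wf_node_iff, rootConn]
    · rintro t h ⟨ts, _, rfl⟩
      exact h.2 rfl
  rw [e2, clS_wfnode]
  rw [clS_chd_symm] at e1
  simp only [Bool.not_true] at e1
  linear_combination -e1

lemma countIn_eq (𝒯 : Set (AT n)) (m : ℕ) : countIn n 𝒯 m = cl (fun t => t ∈ 𝒯 ∧ WF t) m := by
  unfold countIn cl
  simp only [and_assoc]

/-- trees whose leaf-root (if any) is allowed by the partial assignment `g` -/
def alw (g : Fin n → Option Bool) (t : AT n) : Prop := ∀ i b, t = .leaf i b → g i = some b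

lemma clS_alw (g : Fin n → Option Bool) :
    clS (fun t => chd false t ∧ alw g t) = clS (chd (n := n) false) -
      C ((Finset.univ.filter fun p : Fin n × Bool => ¬ g p.1 = some p.2).card : ℝ) * X := by
  have := cl_leaf (n := n) (fun i b => ¬ g i = some b)
  rw [← this, eq_sub_iff_add_eq, ← clS_or]
  · refine clS_congr fun t => ?_
    cases t with
    | leaf i b =>
      simp [chd, alw, rootConn, WF.leaf]; tauto
    | node d ts => simp [chd, alw]
  · rintro t h ⟨i, b, h2, rfl⟩
    exact h2 (h.2 i b rfl)

lemma card_disallowed (g : Fin n → Option Bool) :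
    (Finset.univ.filter fun p : Fin n × Bool => ¬ g p.1 = some p.2).card =
      ∑ i, (if g i = none then 2 else 1) := by
  rw [Finset.card_filter, Fintype.sum_prod_type]
  refine Finset.sum_congr rfl fun i _ => ?_
  rcases h : g i with _ | b
  · simp [h]
  · cases b <;> simp [h]

/-- sign of a partial assignment -/
noncomputable def sg (g : Fin n → Option Bool) : ℝ := ∏ i, if g i = none then (-1 : ℝ) else 1

open Classical in
lemma incl_excl (ts : List (AT n)) :
    (if ∃ i, AT.leaf i true ∈ ts ∧ AT.leaf i false ∈ ts then (1:ℝ) else 0) =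
      1 - ∑ g : Fin n → Option Bool, sg g * (if ∀ t ∈ ts, alw g t then 1 else 0) := by
  have h1 : ∀ g : Fin n → Option Bool, sg g * (if ∀ t ∈ ts, alw g t then (1:ℝ) else 0) =
      ∏ i, ((if g i = none then (-1 : ℝ) else 1) *
        (if ∀ b, AT.leaf i b ∈ ts → g i = some b then (1:ℝ) else 0)) := by
    intro g
    rw [Finset.prod_mul_distrib, sg, Finset.prod_ite_zero]
    congr 1
    simp only [Finset.prod_const_one, Finset.mem_univ, true_implies]
    refine if_congr ⟨fun h i b hb => h _ hb i b rfl, ?_⟩ rfl rfl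
    rintro h t ht i b rfl
    exact h i b ht
  rw [Finset.sum_congr rfl fun g _ => h1 g]
  have h2 := Finset.prod_univ_sum (ι := Fin n) (t := fun _ => (Finset.univ : Finset (Option Bool)))
    (f := fun i o => (if o = none then (-1 : ℝ) else 1) *
        (if ∀ b, AT.leaf i b ∈ ts → o = some b then (1:ℝ) else 0))
  rw [Fintype.piFinset_univ] at h2
  rw [← h2]
  have h3 : ∀ i : Fin n, (∑ o : Option Bool, (if o = none then (-1 : ℝ) else 1) *
        (if ∀ b, AT.leaf i b ∈ ts → o = some b then (1:ℝ) else 0)) =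
        if ¬ (AT.leaf i true ∈ ts ∧ AT.leaf i false ∈ ts) then 1 else 0 := by
    intro i
    by_cases ht : AT.leaf i true ∈ ts <;> by_cases hf : AT.leaf i false ∈ ts <;>
      simp [Fintype.sum_option, ht, hf]
    norm_num
  rw [Finset.prod_congr rfl fun i _ => h3 i, Finset.prod_ite_zero]
  simp only [Finset.prod_const_one, Finset.mem_univ, true_implies]
  by_cases h : ∃ i, AT.leaf i true ∈ ts ∧ AT.leaf i false ∈ ts
  · rw [if_pos h, if_neg (by push Not; exact h)]; simp
  · rw [if_neg h, if_pos (by simpa using h)]; simp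

open Classical in
lemma card_filter_lists (P : List (AT n) → Prop) (m : ℕ) :
    (Nat.card {ts : List (AT n) // P ts ∧ sizeList ts = m} : ℝ) =
      ∑ ts ∈ (finite_sizeList (n := n) m).toFinset, if P ts then (1:ℝ) else 0 := by
  rw [Finset.sum_boole]
  congr 1
  refine Nat.subtype_card _ fun ts => ?_
  simp [and_comm]

lemma clS_simple : clS (fun t : AT n => t ∈ SimpleTauto n ∧ WF t) =
    X * llS (chd (n := n) false) - ∑ g : Fin n → Option Bool,
      C (sg g) * (X * llS (fun t => chd false t ∧ alw g t)) := by
  classical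
  have e1 : clS (fun t : AT n => t ∈ SimpleTauto n ∧ WF t) =
      clS (fun t : AT n => ∃ ts, ((∀ t ∈ ts, chd false t) ∧
        ∃ i, AT.leaf i true ∈ ts ∧ AT.leaf i false ∈ ts) ∧ t = .node false ts) := by
    refine clS_congr fun t => ?_
    cases t with
    | leaf i b => simp [SimpleTauto, rootConn]
    | node d ts =>
      have hlen : (∃ i, AT.leaf i true ∈ ts ∧ AT.leaf i false ∈ ts) → 2 ≤ ts.length := by
        rintro ⟨i, h1, h2⟩
        match ts with
        | [] => simp at h1
        | [a] =>
          simp only [List.mem_singleton] at h1 h2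
          rw [← h1] at h2
          simp at h2
        | a :: b :: l => simp
      cases d with
      | true => simp [SimpleTauto, rootConn]
      | false =>
        simp only [SimpleTauto, rootConn, rootChildren, wf_node_iff, Set.mem_ofPred_eq, true_and,
          AT.node.injEq]
        constructor
        · rintro ⟨h1, h2, h3⟩
          exact ⟨ts, ⟨h3, h1⟩, rfl⟩
        · rintro ⟨ts', ⟨h3, h1⟩, rfl⟩
          exact ⟨h1, hlen h1, h3⟩
  rw [e1]
  ext m
  cases m with
  | zero => simp [clS, cl_zero]
  | succ m =>
    simp only [map_sub, map_sum, coeff_C_mul, coeff_succ_X_mul, clS, llS, coeff_mk, cl_node, ll,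
      card_filter_lists]
    simp only [Finset.mul_sum]
    rw [Finset.sum_comm, ← Finset.sum_sub_distrib]
    refine Finset.sum_congr rfl fun ts _ => ?_
    by_cases h : ∀ t ∈ ts, chd false t
    · have h2 : ∀ g : Fin n → Option Bool, (∀ t ∈ ts, chd false t ∧ alw g t) ↔
          ∀ t ∈ ts, alw g t := fun g => ⟨fun h' t ht => (h' t ht).2, fun h' t ht => ⟨h t ht, h' t ht⟩⟩
      simp only [h2, if_pos h]
      rw [← incl_excl ts]
      have h3 := and_iff_right (b := ∃ i, AT.leaf i true ∈ ts ∧ AT.leaf i false ∈ ts) h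
      simp only [h3]
    · have h2 : ∀ g : Fin n → Option Bool, ¬ (∀ t ∈ ts, chd false t ∧ alw g t) :=
        fun g h' => h fun t ht => (h' t ht).1
      simp only [h, h2, false_and, if_false, mul_zero, Finset.sum_const_zero, sub_zero]

end Combi
section Final
open Filter Topology PowerSeries MeasureTheory Set

lemma integral_aux {x : ℝ} (hx : 0 < x) :
    IntegrableOn (fun s : ℝ => s * Real.exp (-(x * s))) (Ioi 0) ∧
    ∫ s in Ioi (0:ℝ), s * Real.exp (-(x * s)) = 1 / x ^ 2 := by
  have key := Real.integral_rpow_mul_exp_neg_mul_Ioi (a := 2) (r := x) two_pos hx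
  have h1 : (fun t : ℝ => t ^ ((2:ℝ) - 1) * Real.exp (-(x * t))) =
      fun t => t * Real.exp (-(x * t)) := by
    funext t; norm_num
  rw [h1] at key
  have h2 : (1 / x) ^ (2:ℝ) * Real.Gamma 2 = 1 / x ^ 2 := by
    rw [Real.Gamma_two, mul_one, Real.rpow_two, div_pow, one_pow]
  rw [h2] at key
  refine ⟨?_, key⟩
  exact .of_integral_ne_zero (by rw [key]; positivity)

lemma integral_tail : ∫ s in Ioi (2:ℝ), s * Real.exp (-(1 * s)) = 3 * Real.exp (-2) := by
  have h_integrable : IntegrableOn (fun s : ℝ => s * Real.exp (-(1 * s))) (Ioi 2) :=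
    (integral_aux one_pos).1.mono_set (Ioi_subset_Ioi (by norm_num))
  have hlim : Tendsto (fun s : ℝ => -((s + 1) * Real.exp (-s))) atTop (𝓝 0) := by
    have h1 := Real.tendsto_pow_mul_exp_neg_atTop_nhds_zero 1
    have h0 := Real.tendsto_pow_mul_exp_neg_atTop_nhds_zero 0
    have := (h1.add h0).neg
    simp only [add_zero, neg_zero] at this
    refine this.congr fun s => ?_
    ring
  have := integral_Ioi_of_hasDerivAt_of_tendsto' (a := (2:ℝ)) (m := 0)
    (f := fun s : ℝ => -((s + 1) * Real.exp (-s))) (f' := fun s => s * Real.exp (-(1 * s)))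
    (fun s _ => by
      have h1 : HasDerivAt (fun s : ℝ => Real.exp (-s)) (Real.exp (-s) * (-1)) s :=
        (hasDerivAt_neg s).exp
      have h2 := (((hasDerivAt_id s).add_const 1).mul h1).neg
      convert! h2 using 1
      simp; ring) h_integrable hlim
  rw [this]; ring

/-- number of disallowed literals -/
noncomputable def cg {n : ℕ} (g : Fin n → Option Bool) : ℝ := ∑ i, (if g i = none then 2 else 1)

lemma cg_nonneg {n : ℕ} (g : Fin n → Option Bool) : 0 ≤ cg g :=
  Finset.sum_nonneg fun i _ => by split_ifs <;> norm_num

lemma cg_le {n : ℕ} (g : Fin n → Option Bool) : cg g ≤ 2 * n := by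
  have : cg g ≤ ∑ _i : Fin n, (2:ℝ) := Finset.sum_le_sum fun i _ => by split_ifs <;> norm_num
  refine this.trans (by simp [mul_comm])

lemma sum_exp {n : ℕ} (x : ℝ) : ∑ g : Fin n → Option Bool, sg g * Real.exp (-(x * cg g)) =
    (1 - (1 - Real.exp (-x)) ^ 2) ^ n := by
  have h1 : ∀ g : Fin n → Option Bool, sg g * Real.exp (-(x * cg g)) =
      ∏ i, ((if g i = none then (-1:ℝ) else 1) *
        Real.exp (-(x * (if g i = none then 2 else 1)))) := by
    intro g
    rw [Finset.prod_mul_distrib, ← Real.exp_sum, sg, cg, Finset.mul_sum, Finset.sum_neg_distrib]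
  rw [Finset.sum_congr rfl fun g _ => h1 g]
  have h2 := Finset.prod_univ_sum (ι := Fin n) (t := fun _ => (Finset.univ : Finset (Option Bool)))
    (f := fun _ o => (if o = none then (-1:ℝ) else 1) *
        Real.exp (-(x * (if o = none then 2 else 1))))
  rw [Fintype.piFinset_univ] at h2
  rw [← h2, Finset.prod_const]
  simp only [Finset.card_univ, Fintype.card_fin]
  congr 1
  have h3 : Real.exp (-(x * 2)) = Real.exp (-x) ^ 2 := by
    rw [← Real.exp_nat_mul]; congr 1; push_cast; ring
  simp [Fintype.sum_option, h3]
  ring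

lemma pow_le_aux {y : ℝ} (hy0 : 0 ≤ y) (hy1 : y ≤ 1) (n : ℕ) : (1 - y) ^ n ≤ 1 / (1 + n * y) := by
  have h1 : (1 - y) ^ n ≤ Real.exp (-(n * y)) := by
    have : 1 - y ≤ Real.exp (-y) := by have := Real.add_one_le_exp (-y); linarith
    calc (1 - y) ^ n ≤ Real.exp (-y) ^ n := pow_le_pow_left₀ (by linarith) this n
      _ = _ := by rw [← Real.exp_nat_mul]; congr 1; ring
  refine h1.trans ?_
  rw [Real.exp_neg, ← one_div]
  apply one_div_le_one_div_of_le (by positivity)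
  have := Real.add_one_le_exp (n * y); linarith

lemma low_bound {n : ℕ} {r : ℝ} (hr : r ^ 2 = 2 * n) (hr1 : 100 ≤ r) :
    (0.12161 : ℝ) ≤ (1 + 1 / (r ^ 2 + 2 * r)) / 2 *
      (1 - ∑ g : Fin n → Option Bool, sg g / (1 + (r + 1) / (r ^ 2 + 2 * r) * cg g) ^ 2) := by
  set κ := (r + 1) / (r ^ 2 + 2 * r) with hκ
  have hκ0 : 0 < κ := by positivity
  have hx : ∀ g : Fin n → Option Bool, 0 < 1 + κ * cg g := fun g => by
    have := cg_nonneg g; positivity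
  set F : ℝ → ℝ := fun s => s * Real.exp (-(1 * s)) -
    ∑ g : Fin n → Option Bool, sg g * (s * Real.exp (-((1 + κ * cg g) * s))) with hF
  have hsumint : IntegrableOn (fun s : ℝ => ∑ g : Fin n → Option Bool,
      sg g * (s * Real.exp (-((1 + κ * cg g) * s)))) (Ioi 0) :=
    integrable_finsetSum _ fun g _ => (integral_aux (hx g)).1.const_mul _
  have hFint : IntegrableOn F (Ioi 0) := (integral_aux one_pos).1.sub hsumint
  have hFval : ∫ s in Ioi (0:ℝ), F s = 1 - ∑ g : Fin n → Option Bool, sg g / (1 + κ * cg g) ^ 2 := by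
    rw [hF, integral_sub (integral_aux one_pos).1 hsumint, (integral_aux one_pos).2,
      integral_finsetSum _ fun g _ => (integral_aux (hx g)).1.const_mul _]
    congr 1
    · norm_num
    · refine Finset.sum_congr rfl fun g _ => ?_
      rw [integral_const_mul, (integral_aux (hx g)).2, mul_one_div]
  have hFform : ∀ s, F s = s * Real.exp (-(1 * s)) * (1 - (1 - (1 - Real.exp (-(κ * s))) ^ 2) ^ n) := by
    intro s
    rw [← sum_exp, mul_sub, mul_one, Finset.mul_sum]
    simp only [hF]
    congr 1
    refine Finset.sum_congr rfl fun g _ => ?_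
    have : Real.exp (-((1 + κ * cg g) * s)) = Real.exp (-(1 * s)) * Real.exp (-(κ * s * cg g)) := by
      rw [← Real.exp_add]; congr 1; ring
    rw [this]; ring
  have hw : ∀ s, 0 < s → 0 ≤ (1 - Real.exp (-(κ * s))) ^ 2 ∧ (1 - Real.exp (-(κ * s))) ^ 2 ≤ 1 := by
    intro s hs
    have h1 : Real.exp (-(κ * s)) ≤ 1 := Real.exp_le_one_iff.2 (by nlinarith [mul_pos hκ0 hs])
    have h2 := Real.exp_pos (-(κ * s))
    exact ⟨sq_nonneg _, by nlinarith⟩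
  have hF0 : ∀ s, 0 < s → 0 ≤ F s := by
    intro s hs
    obtain ⟨h1, h2⟩ := hw s hs
    rw [hFform]
    have h3 : (1 - (1 - Real.exp (-(κ * s))) ^ 2) ^ n ≤ 1 := pow_le_one₀ (by linarith) (by linarith)
    have : 0 ≤ 1 - (1 - (1 - Real.exp (-(κ * s))) ^ 2) ^ n := by linarith
    positivity
  have hF2 : ∀ s, 2 < s → 8 / 13 * (s * Real.exp (-(1 * s))) ≤ F s := by
    intro s hs
    obtain ⟨h1, h2⟩ := hw s (by linarith)
    have h3 := pow_le_aux h1 h2 n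
    have hk1 : 1 / (r + 1) ≤ κ := by
      rw [hκ, div_le_div_iff₀ (by positivity) (by positivity)]; nlinarith
    have hv : 2 / (r + 3) ≤ 1 - Real.exp (-(κ * s)) := by
      have h4 : 2 / (r + 1) ≤ κ * s := by
        calc 2 / (r + 1) = 1 / (r+1) * 2 := by ring
          _ ≤ κ * s := by gcongr
      have h5 : Real.exp (-(κ * s)) ≤ 1 / (1 + 2 / (r+1)) := by
        rw [Real.exp_neg, ← one_div]
        apply one_div_le_one_div_of_le (by positivity)
        have := Real.add_one_le_exp (κ * s); linarith
      have h6 : 1 / (1 + 2 / (r+1)) = 1 - 2 / (r + 3) := by field_simp; ring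
      linarith
    have hv2 : (2 / (r+3)) ^ 2 ≤ (1 - Real.exp (-(κ * s))) ^ 2 := pow_le_pow_left₀ (by positivity) hv 2
    have hny : 8 / 5 ≤ n * (1 - Real.exp (-(κ * s))) ^ 2 := by
      have : 8 / 5 ≤ (n:ℝ) * (2 / (r+3))^2 := by
        rw [show (n:ℝ) = r^2 / 2 by linarith]
        have : r ^ 2 / 2 * (2 / (r+3))^2 = 2 * r^2 / (r+3)^2 := by field_simp
        rw [this, div_le_div_iff₀ (by norm_num) (by positivity)]
        nlinarith
      refine this.trans ?_
      gcongr
    have h7 : 1 / (1 + (n:ℝ) * (1 - Real.exp (-(κ * s))) ^ 2) ≤ 5 / 13 := by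
      rw [div_le_div_iff₀ (by linarith) (by norm_num)]; linarith
    rw [hFform, mul_comm (8/13 : ℝ)]
    have hs0 : 0 < s := by linarith
    gcongr
    linarith
  have hI : 8 / 13 * (3 * Real.exp (-2)) ≤ ∫ s in Ioi (0:ℝ), F s := by
    have hsub : Ioi (2:ℝ) ⊆ Ioi 0 := Ioi_subset_Ioi (by norm_num)
    calc 8 / 13 * (3 * Real.exp (-2)) = ∫ s in Ioi (2:ℝ), 8 / 13 * (s * Real.exp (-(1 * s))) := by
          rw [integral_const_mul, integral_tail]
      _ ≤ ∫ s in Ioi (2:ℝ), F s := by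
          refine setIntegral_mono_on (((integral_aux one_pos).1.mono_set hsub).const_mul _)
            (hFint.mono_set hsub) measurableSet_Ioi fun s hs => hF2 s hs
      _ ≤ ∫ s in Ioi (0:ℝ), F s := by
          refine setIntegral_mono_set hFint ?_ hsub.eventuallyLE
          exact (ae_restrict_iff' measurableSet_Ioi).2 (ae_of_all _ fun s hs => hF0 s hs)
  rw [hFval] at hI
  have he2 : (0.135 : ℝ) ≤ Real.exp (-2) := by
    have h1 : Real.exp (-2) = 1 / (Real.exp 1) ^ 2 := by
      rw [← Real.exp_nat_mul, Real.exp_neg, one_div]; norm_num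
    have h2 := Real.exp_one_lt_d9
    have h3 := Real.exp_pos 1
    rw [h1, le_div_iff₀ (by positivity)]
    have : (Real.exp 1)^2 ≤ 2.7182818286 ^ 2 := by gcongr
    nlinarith
  have hρ : 0 < 1 / (r ^ 2 + 2 * r) := by positivity
  nlinarith

lemma ratio_limit (n : ℕ) (hn : 1 ≤ n) : HasLimRatio n (SimpleTauto n)
    ((1 + 1 / (√(2 * n) ^ 2 + 2 * √(2 * n))) / 2 *
      (1 - ∑ g : Fin n → Option Bool,
        sg g / (1 + (√(2 * n) + 1) / (√(2 * n) ^ 2 + 2 * √(2 * n)) * cg g) ^ 2)) := by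
  set r := √(2 * (n:ℝ)) with hrdef
  have hn' : (1:ℝ) ≤ n := by exact_mod_cast hn
  have hr2 : r ^ 2 = 2 * n := Real.sq_sqrt (by positivity)
  have hr1 : 1 ≤ r := by rw [hrdef, Real.one_le_sqrt]; linarith
  have hB := clS_chd (n := n) false
  rw [Bool.not_false] at hB
  have hV := llS_mul (chd (n := n) false)
  have hsymm := clS_chd_symm (n := n)
  have hV1 := llS_mul (chd (n := n) true)
  have hVV : llS (chd (n := n) true) = llS (chd (n := n) false) := by
    rw [hsymm] at hV1
    linear_combination (-llS (chd (n := n) true)) * hV + llS (chd (n := n) false) * hV1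
  rw [hsymm, hVV, ← hr2] at hB
  obtain ⟨e, β, he, hβ, hBl, hW⟩ := core_limit hr1 (by rw [hr2]; linarith) hV hB
  set ρ := 1 / (r ^ 2 + 2 * r)
  set κ := (r + 1) / (r ^ 2 + 2 * r)
  have hA : HasL e (clS (fun t : AT n => t ∈ (Set.univ : Set (AT n)) ∧ WF t)) (2 * β) := by
    rw [clS_all]
    have := (hBl.add hBl).sub (HasL.quad0 (e := e) 0 (2 * n) 0)
    convert! this using 1
    · simp [quad]
    · ring
  have hVl := hW 0 (llS (chd (n := n) false)) le_rfl (by positivity) (by simpa using hV)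
  have hg : ∀ g : Fin n → Option Bool, HasL e (X * llS (fun t => chd false t ∧ alw g t))
      (β * (1 + ρ) / (1 + κ * cg g) ^ 2) := by
    intro g
    refine hW (cg g) _ (cg_nonneg g) (by rw [hr2]; exact cg_le g) ?_
    have h1 := llS_mul (fun t => chd false t ∧ alw g t)
    rw [clS_alw, card_disallowed] at h1
    have hc : ((∑ i, (if g i = none then 2 else 1) : ℕ) : ℝ) = cg g := by
      rw [cg]; push_cast; rfl
    rw [hc] at h1
    linear_combination h1
  have hS : HasL e (clS (fun t : AT n => t ∈ SimpleTauto n ∧ WF t))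
      (β * (1 + ρ) / (1 + κ * 0) ^ 2 - ∑ g : Fin n → Option Bool,
        sg g * (β * (1 + ρ) / (1 + κ * cg g) ^ 2)) := by
    rw [clS_simple]
    exact hVl.sub (HasL.sum _ fun g _ => (hg g).smul (sg g))
  have hdiv := Tendsto.div hS hA (by simpa using hβ)
  unfold HasLimRatio
  convert! hdiv using 1
  · funext m
    simp only [ratio, A, countIn_eq, clS, coeff_mk, Pi.div_apply]
    have := (he.pos m).ne'
    rw [div_div_div_cancel_right₀ this]
  · have : ∑ g : Fin n → Option Bool, sg g * (β * (1 + ρ) / (1 + κ * cg g) ^ 2) =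
        β * (1 + ρ) * ∑ g : Fin n → Option Bool, sg g / (1 + κ * cg g) ^ 2 := by
      rw [Finset.mul_sum]
      refine Finset.sum_congr rfl fun g _ => by ring
    rw [this, mul_zero, add_zero, one_pow, div_one]
    field_simp

lemma ratio_le_one (n m : ℕ) (𝒯 : Set (AT n)) : ratio n 𝒯 m ≤ 1 := by
  refine div_le_one_of_le₀ ?_ (Nat.cast_nonneg _)
  rw [A, countIn_eq, countIn_eq]
  exact_mod_cast Set.ncard_le_ncard (s := {t : AT n | (t ∈ 𝒯 ∧ WF t) ∧ size t = m})
    (t := {t : AT n | (t ∈ Set.univ ∧ WF t) ∧ size t = m})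
    (fun t h => ⟨⟨trivial, h.1.2⟩, h.2⟩) (finite_cl _ m)

lemma exists_limit (n : ℕ) : ∃ μ : ℝ, HasLimRatio n (SimpleTauto n) μ ∧
    (5000 ≤ n → (0.12161 : ℝ) ≤ μ) := by
  rcases Nat.eq_zero_or_pos n with h | h
  · subst h
    refine ⟨0, ?_, fun h => absurd h (by norm_num)⟩
    have : ratio 0 (SimpleTauto 0) = fun _ => 0 := by
      funext m
      have : IsEmpty {t : AT 0 // t ∈ SimpleTauto 0 ∧ WF t ∧ size t = m} := ⟨by
        rintro ⟨t, ⟨_, i, _⟩, _⟩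
        exact i.elim0⟩
      simp [ratio, countIn]
    unfold HasLimRatio
    rw [this]
    exact tendsto_const_nhds
  · refine ⟨_, ratio_limit n h, fun hn => low_bound (Real.sq_sqrt (by positivity)) ?_⟩
    apply Real.le_sqrt_of_sq_le
    have : (5000:ℝ) ≤ n := by exact_mod_cast hn
    linarith

end Final

open Filter in
/-- For every `n` the limiting ratio of the set of simple tautologies exists, and
its liminf as `n → ∞` is at least `0.12161`. -/
theorem statement13 :
    ∃ μ : ℕ → ℝ, (∀ n : ℕ, HasLimRatio n (SimpleTauto n) (μ n)) ∧
      (0.12161 : ℝ) ≤ liminf (fun n : ℕ => μ n) atTop := by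
  choose μ h1 h2 using exists_limit
  refine ⟨μ, h1, ?_⟩
  have hle : ∀ n, μ n ≤ 1 := fun n =>
    le_of_tendsto (h1 n) (Eventually.of_forall fun m => ratio_le_one n m _)
  refine le_liminf_of_le ?_ ?_
  · exact (isBoundedUnder_of ⟨1, hle⟩ : IsBoundedUnder (· ≤ ·) atTop μ).isCoboundedUnder_ge
  · filter_upwards [eventually_ge_atTop 5000] with n hn using h2 n hn
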